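/- Let μ ≥ ν > −1. The function g_{μ,ν} : [0, α_{ν,1}²) → (0,∞) defined by g_{μ,ν}(x) = x^{(ν−μ)/2} e^{(3x/4)(1/(μ+1) − 1/(ν+1))} d_μ(√x)/d_ν(√x) is absolutely monotonic on [0, α_{ν,1}²), i.e., g_{μ,ν}^{(m)}(x) ≥ 0 for all integers m ≥ 0 and all x ∈ [0, α_{ν,1}²). -/

import Mathlib

open Real Filter Set

/-- The Bessel function of the first kind of order `ν`, defined by its power series. -/
noncomputable def besselJ (ν x : ℝ) : ℝ :=
  ∑' n : ℕ, (-1 : ℝ) ^ n * x ^ (2 * (n : ℝ) + ν) /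
    (2 ^ (2 * (n : ℝ) + ν) * (n.factorial : ℝ) * Real.Gamma ((n : ℝ) + ν + 1))

/-- The Dini function `d_ν(x) = (1-ν) J_ν(x) + x J_ν'(x) = J_ν(x) - x J_{ν+1}(x)`. -/
noncomputable def dini (ν x : ℝ) : ℝ :=
  besselJ ν x - x * besselJ (ν + 1) x

open PowerSeries in
/-- Coefficientwise domination `0 ≤ p ≤ q` of power series. -/
def CoeffDominated (p q : PowerSeries ℝ) : Prop :=
  ∀ n, 0 ≤ coeff n p ∧ coeff n p ≤ coeff n q

namespace CoeffDominated

open PowerSeries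

variable {p q p' q' : PowerSeries ℝ}

theorem coeff_mul_le (n : ℕ) (h : ∀ i ≤ n, 0 ≤ coeff i p ∧ coeff i p ≤ coeff i q)
    (h' : ∀ i ≤ n, 0 ≤ coeff i p' ∧ coeff i p' ≤ coeff i q') :
    0 ≤ coeff n (p * p') ∧ coeff n (p * p') ≤ coeff n (q * q') := by
  simp only [coeff_mul]
  constructor
  · refine Finset.sum_nonneg fun x hx => ?_
    have := Finset.HasAntidiagonal.mem_antidiagonal.1 hx
    exact mul_nonneg (h x.1 (by omega)).1 (h' x.2 (by omega)).1
  · refine Finset.sum_le_sum fun x hx => ?_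
    have := Finset.HasAntidiagonal.mem_antidiagonal.1 hx
    have h1 := h x.1 (by omega)
    have h2 := h' x.2 (by omega)
    exact mul_le_mul h1.2 h2.2 h2.1 (h1.1.trans h1.2)

theorem mul (h : CoeffDominated p q) (h' : CoeffDominated p' q') :
    CoeffDominated (p * p') (q * q') :=
  fun n => coeff_mul_le n (fun i _ => h i) (fun i _ => h' i)

theorem add (h : CoeffDominated p q) (h' : CoeffDominated p' q') :
    CoeffDominated (p + p') (q + q') := fun n => by
  simpa using ⟨add_nonneg (h n).1 (h' n).1, add_le_add (h n).2 (h' n).2⟩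

theorem derivative (h : CoeffDominated p q) :
    CoeffDominated (d⁄dX ℝ p) (d⁄dX ℝ q) := fun n => by
  simp only [coeff_derivative]
  exact ⟨mul_nonneg (h _).1 (by positivity),
    mul_le_mul_of_nonneg_right (h _).2 (by positivity)⟩

theorem X_mul (h : CoeffDominated p q) : CoeffDominated (X * p) (X * q) := fun n => by
  cases n with
  | zero => simp
  | succ n => simpa [coeff_succ_X_mul] using h n

theorem of_fixedPoint (h : CoeffDominated p q) (hp : p' = 1 + X * (p * p'))
    (hq : q' = 1 + X * (q * q')) : CoeffDominated p' q' := fun n => by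
  induction n using Nat.strong_induction_on with
  | _ n ih =>
    rw [hp, hq]
    cases n with
    | zero => simp
    | succ n =>
      simpa [coeff_succ_X_mul, coeff_one] using
        coeff_mul_le n (fun i _ => h i) (fun i hi => ih i (by omega))

/-- Monotonicity of the solution of the Riccati equation in its parameter. -/
theorem of_riccati {a b k : ℝ} (hb : 0 < b) (hba : b ≤ a) (hk : 0 ≤ k)
    (hp : X * d⁄dX ℝ p + C a * p = C k + X * (p * p))
    (hq : X * d⁄dX ℝ q + C b * q = C k + X * (q * q)) : CoeffDominated p q := fun n => by
  induction n using Nat.strong_induction_on with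
  | _ n ih =>
    have ep := congrArg (coeff n) hp
    have eq := congrArg (coeff n) hq
    cases n with
    | zero =>
      simp only [map_add, coeff_zero_X_mul, coeff_C_mul, coeff_zero_C, zero_add,
        add_zero] at ep eq
      have ha : 0 < a := hb.trans_le hba
      have e1 : coeff 0 p = k / a := by field_simp; linarith
      have e2 : coeff 0 q = k / b := by field_simp; linarith
      rw [e1, e2]
      exact ⟨by positivity, by gcongr⟩
    | succ n =>
      simp only [map_add, coeff_succ_X_mul, coeff_C_mul, coeff_derivative, coeff_C,
        Nat.succ_ne_zero, if_false, zero_add] at ep eq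
      obtain ⟨m1, m2⟩ := coeff_mul_le (p := p) (p' := p) (q := q) (q' := q) n
        (fun i hi => ih i (by omega)) (fun i hi => ih i (by omega))
      have hb' : 0 < (n : ℝ) + 1 + b := by positivity
      have ha' : 0 < (n : ℝ) + 1 + a := by linarith
      have e1 : coeff (n + 1) p = coeff n (p * p) / ((n : ℝ) + 1 + a) := by
        field_simp; linarith
      have e2 : coeff (n + 1) q = coeff n (q * q) / ((n : ℝ) + 1 + b) := by
        field_simp; linarith
      rw [e1, e2]
      exact ⟨by positivity, div_le_div₀ (m1.trans m2) m2 hb' (by linarith)⟩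

end CoeffDominated

/-- Coefficients of the entire function `x ↦ 2 ^ ν * x ^ (-ν/2) * besselJ ν (√x)`. -/
noncomputable def besselCoeff (ν : ℝ) (n : ℕ) : ℝ :=
  (-1) ^ n / (4 ^ n * n.factorial * Real.Gamma (n + ν + 1))

/-- Coefficients of the entire function `x ↦ 2 ^ ν * x ^ (-ν/2) * dini ν (√x)`. -/
noncomputable def diniCoeff (ν : ℝ) (n : ℕ) : ℝ := (2 * n + 1) * besselCoeff ν n

section Formal

open PowerSeries

variable {ν : ℝ}

theorem gamma_shift_pos (hν : -1 < ν) (n : ℕ) : 0 < Real.Gamma (n + ν + 1) :=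
  Real.Gamma_pos_of_pos (by have : (0 : ℝ) ≤ n := n.cast_nonneg; linarith)

theorem besselCoeff_succ (hν : -1 < ν) (n : ℕ) :
    4 * ((n : ℝ) + 1) * (n + ν + 1) * besselCoeff ν (n + 1) = -besselCoeff ν n := by
  have hp : (0 : ℝ) < n + ν + 1 := by have : (0 : ℝ) ≤ n := n.cast_nonneg; linarith
  have hG := gamma_shift_pos hν n
  have e : ((n + 1 : ℕ) : ℝ) + ν + 1 = (n + ν + 1) + 1 := by push_cast; ring
  unfold besselCoeff
  rw [e, Real.Gamma_add_one hp.ne', Nat.factorial_succ]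
  push_cast
  field_simp
  ring

theorem besselCoeff_ne_zero (hν : -1 < ν) (n : ℕ) : besselCoeff ν n ≠ 0 := by
  have := gamma_shift_pos hν n
  unfold besselCoeff
  exact div_ne_zero (by simp) (by positivity)

theorem besselCoeff_zero_pos (hν : -1 < ν) : 0 < besselCoeff ν 0 := by
  have := gamma_shift_pos hν 0
  unfold besselCoeff
  simp only [pow_zero, Nat.factorial_zero]
  positivity

/-- The formal power series with coefficients `besselCoeff`. -/
noncomputable def besselSeries (ν : ℝ) : PowerSeries ℝ := PowerSeries.mk (besselCoeff ν)

/-- The formal power series with coefficients `diniCoeff`. -/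
noncomputable def diniSeries (ν : ℝ) : PowerSeries ℝ := PowerSeries.mk (diniCoeff ν)

/-- The negative logarithmic derivative of `besselSeries`; its coefficients are the Rayleigh sums
of the Bessel function. -/
noncomputable def besselLogDeriv (ν : ℝ) : PowerSeries ℝ :=
  -(d⁄dX ℝ (besselSeries ν)) * (besselSeries ν)⁻¹

/-- The series `(1 - 2 X u)⁻¹`, where `u = besselLogDeriv ν`. -/
noncomputable def diniCorrection (ν : ℝ) : PowerSeries ℝ :=
  (1 - X * (2 * besselLogDeriv ν))⁻¹

/-- The negative logarithmic derivative of `diniSeries`; its coefficients are the Rayleigh sums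
of the Dini function. -/
noncomputable def diniLogDeriv (ν : ℝ) : PowerSeries ℝ :=
  let u := besselLogDeriv ν
  let w := u + X * d⁄dX ℝ u
  u + (w + w) * diniCorrection ν

theorem constantCoeff_besselSeries_ne_zero (hν : -1 < ν) :
    constantCoeff (besselSeries ν) ≠ 0 := by
  rw [← coeff_zero_eq_constantCoeff_apply, besselSeries, coeff_mk]
  exact besselCoeff_ne_zero hν 0

theorem besselLogDeriv_mul (hν : -1 < ν) :
    besselLogDeriv ν * besselSeries ν = -(d⁄dX ℝ (besselSeries ν)) := by
  rw [besselLogDeriv, mul_assoc, PowerSeries.inv_mul_cancel _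
    (constantCoeff_besselSeries_ne_zero hν), mul_one]

theorem besselSeries_ode (hν : -1 < ν) :
    X * d⁄dX ℝ (d⁄dX ℝ (besselSeries ν)) + C (ν + 1) * d⁄dX ℝ (besselSeries ν) +
      C (1 / 4) * besselSeries ν = 0 := by
  ext n
  have h := besselCoeff_succ hν n
  cases n with
  | zero =>
    simp only [map_add (coeff 0), coeff_zero_X_mul, coeff_C_mul, coeff_derivative, besselSeries, coeff_mk,
      map_zero]
    push_cast at h ⊢
    linarith
  | succ n =>
    simp only [map_add (coeff (n + 1)), coeff_succ_X_mul, coeff_C_mul, coeff_derivative, besselSeries, coeff_mk,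
      map_zero]
    push_cast at h ⊢
    linarith

theorem besselLogDeriv_riccati (hν : -1 < ν) :
    X * d⁄dX ℝ (besselLogDeriv ν) + C (ν + 1) * besselLogDeriv ν =
      C (1 / 4) + X * (besselLogDeriv ν * besselLogDeriv ν) := by
  have hF : besselSeries ν ≠ 0 := fun h => constantCoeff_besselSeries_ne_zero hν (by simp [h])
  have h1 := besselLogDeriv_mul hν
  have h2 := congrArg (d⁄dX ℝ) h1
  rw [Derivation.leibniz, map_neg, smul_eq_mul, smul_eq_mul] at h2
  have h3 := besselSeries_ode hν
  refine mul_right_cancel₀ hF ?_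
  linear_combination X * h2 - h3 + (C (ν + 1) - X * besselLogDeriv ν) * h1

theorem coeff_zero_besselLogDeriv (hν : -1 < ν) :
    coeff 0 (besselLogDeriv ν) = 1 / (4 * (ν + 1)) := by
  have h := congrArg (coeff 0) (besselLogDeriv_riccati hν)
  simp only [map_add (coeff 0), coeff_zero_X_mul, coeff_C_mul, coeff_zero_C, zero_add, add_zero] at h
  have : 0 < ν + 1 := by linarith
  field_simp
  linarith

theorem diniCorrection_mul (ν : ℝ) :
    diniCorrection ν * (1 - X * (2 * besselLogDeriv ν)) = 1 :=
  PowerSeries.inv_mul_cancel _ (by simp)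

theorem diniSeries_eq (hν : -1 < ν) :
    diniSeries ν = besselSeries ν * (1 - X * (2 * besselLogDeriv ν)) := by
  have h : diniSeries ν = besselSeries ν + C 2 * (X * d⁄dX ℝ (besselSeries ν)) := by
    ext n
    cases n with
    | zero => simp [diniSeries, besselSeries, diniCoeff]
    | succ n =>
      simp only [diniSeries, besselSeries, diniCoeff, map_add, coeff_C_mul, coeff_succ_X_mul,
        coeff_derivative, coeff_mk]
      push_cast
      ring
  have h2 : (C 2 : PowerSeries ℝ) = 2 := map_ofNat C 2
  rw [h, h2]
  linear_combination (2 * X) * besselLogDeriv_mul hν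

theorem derivative_diniSeries (hν : -1 < ν) :
    d⁄dX ℝ (diniSeries ν) = -(diniLogDeriv ν * diniSeries ν) := by
  have h2 : d⁄dX ℝ (2 : PowerSeries ℝ) = 0 := by
    rw [← map_ofNat (C : ℝ →+* PowerSeries ℝ) 2]; exact derivative_C
  have h : d⁄dX ℝ (diniSeries ν) =
      d⁄dX ℝ (besselSeries ν) * (1 - X * (2 * besselLogDeriv ν)) -
      besselSeries ν * (2 * besselLogDeriv ν + X * (2 * d⁄dX ℝ (besselLogDeriv ν))) := by
    rw [diniSeries_eq hν]
    simp only [Derivation.leibniz, map_sub, smul_eq_mul, derivative_X, derivative_one, h2]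
    ring
  rw [h, diniLogDeriv, diniSeries_eq hν]
  have h3 := diniCorrection_mul ν
  have h1 := besselLogDeriv_mul hν
  linear_combination (1 - X * (2 * besselLogDeriv ν)) * h1 +
    2 * (besselLogDeriv ν + X * d⁄dX ℝ (besselLogDeriv ν)) * besselSeries ν * h3

theorem coeff_zero_diniLogDeriv (hν : -1 < ν) :
    coeff 0 (diniLogDeriv ν) = 3 / 4 * (1 / (ν + 1)) := by
  have h : coeff 0 (diniCorrection ν) = 1 := by
    have := congrArg (coeff 0) (diniCorrection_mul ν)
    rw [coeff_mul] at this
    simpa using this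
  have h0 := coeff_zero_besselLogDeriv hν
  simp only [coeff_zero_eq_constantCoeff_apply, diniLogDeriv, map_add, map_mul] at h h0 ⊢
  rw [h, h0]
  have : ν + 1 ≠ 0 := by linarith
  simp
  field_simp
  norm_num

theorem diniLogDeriv_dominated {μ : ℝ} (hν : -1 < ν) (hμν : ν ≤ μ) :
    CoeffDominated (diniLogDeriv μ) (diniLogDeriv ν) := by
  have hμ : -1 < μ := hν.trans_le hμν
  have hu : CoeffDominated (besselLogDeriv μ) (besselLogDeriv ν) :=
    .of_riccati (by linarith) (by linarith) (by norm_num) (besselLogDeriv_riccati hμ)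
      (besselLogDeriv_riccati hν)
  have hV : CoeffDominated (diniCorrection μ) (diniCorrection ν) := by
    refine .of_fixedPoint (hu.add hu) ?_ ?_
    · linear_combination diniCorrection_mul μ
    · linear_combination diniCorrection_mul ν
  have hw := hu.add hu.derivative.X_mul
  exact hu.add ((hw.add hw).mul hV)

theorem coeff_nonneg_of_derivative_eq_mul {G H : PowerSeries ℝ} (h0 : 0 ≤ coeff 0 G)
    (hH : ∀ n, 0 ≤ coeff n H) (h : d⁄dX ℝ G = H * G) (n : ℕ) : 0 ≤ coeff n G := by
  induction n using Nat.strong_induction_on with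
  | _ n ih =>
    cases n with
    | zero => exact h0
    | succ n =>
      have e := congrArg (coeff n) h
      rw [coeff_derivative, coeff_mul] at e
      refine nonneg_of_mul_nonneg_left (b := (n : ℝ) + 1) ?_ (by positivity)
      rw [e]
      refine Finset.sum_nonneg fun x hx => ?_
      have := Finset.HasAntidiagonal.mem_antidiagonal.1 hx
      exact mul_nonneg (hH _) (ih _ (by omega))

/-- A formal quotient `exp (c X) * diniSeries μ / diniSeries ν` has nonnegative coefficients. -/
theorem coeff_nonneg_of_mul_diniSeries {μ : ℝ} (hν : -1 < ν) (hμν : ν ≤ μ)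
    {G E : PowerSeries ℝ} (hE : d⁄dX ℝ E = C (3 / 4 * (1 / (μ + 1) - 1 / (ν + 1))) * E)
    (h0 : 0 ≤ coeff 0 G) (hG : G * diniSeries ν = E * diniSeries μ) (n : ℕ) :
    0 ≤ coeff n G := by
  have hμ : -1 < μ := hν.trans_le hμν
  set c := 3 / 4 * (1 / (μ + 1) - 1 / (ν + 1))
  have hD : diniSeries ν ≠ 0 := fun h => by
    have := congrArg (coeff 0) h
    simp [diniSeries, diniCoeff, besselCoeff_ne_zero hν 0] at this
  refine coeff_nonneg_of_derivative_eq_mul (H := C c + diniLogDeriv ν - diniLogDeriv μ) h0 ?_ ?_ n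
  · intro n
    cases n with
    | zero =>
      simp only [map_add, map_sub, coeff_zero_C, coeff_zero_diniLogDeriv hν,
        coeff_zero_diniLogDeriv hμ, c]
      exact le_of_eq (by ring)
    | succ n =>
      have := diniLogDeriv_dominated hν hμν (n + 1)
      simp only [map_add, map_sub, coeff_C, Nat.succ_ne_zero, if_false]
      linarith
  · have h := congrArg (d⁄dX ℝ) hG
    simp only [Derivation.leibniz, smul_eq_mul, hE, derivative_diniSeries hν,
      derivative_diniSeries hμ] at h
    refine mul_right_cancel₀ hD ?_
    linear_combination h + (-(diniLogDeriv μ) + C c) * (-hG)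

end Formal

section Analytic

variable {ν : ℝ}

theorem summable_besselCoeff (hν : -1 < ν) (x : ℝ) :
    Summable fun n : ℕ => besselCoeff ν n * x ^ n := by
  refine summable_of_ratio_norm_eventually_le (r := 1 / 2) (by norm_num) ?_
  filter_upwards [eventually_ge_atTop (max 1 ⌈|x|⌉₊)] with n hn
  have h1 : (1 : ℝ) ≤ n := by exact_mod_cast (le_max_left _ _).trans hn
  have hx : |x| ≤ n := (Nat.le_ceil _).trans (by exact_mod_cast (le_max_right _ _).trans hn)
  have h := congrArg abs (besselCoeff_succ hν n)
  have hpos : 0 ≤ 4 * ((n : ℝ) + 1) * (n + ν + 1) := by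
    have : 0 ≤ (n : ℝ) + ν + 1 := by linarith
    positivity
  have hle : 2 * |x| ≤ 4 * ((n : ℝ) + 1) * (n + ν + 1) := by nlinarith
  rw [abs_mul, abs_of_nonneg hpos, abs_neg] at h
  simp only [norm_mul, norm_pow, Real.norm_eq_abs, pow_succ, ← h]
  have h2 : 0 ≤ |besselCoeff ν (n + 1)| * |x| ^ n := by positivity
  nlinarith [mul_le_mul_of_nonneg_left hle h2]

/-- The entire function `x ↦ 2 ^ ν * x ^ (-ν/2) * dini ν (√x)`. -/
noncomputable def diniEntire (ν x : ℝ) : ℝ := ∑' n : ℕ, diniCoeff ν n * x ^ n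

theorem besselCoeff_add_one (hν : -1 < ν) (n : ℕ) :
    besselCoeff (ν + 1) n = -4 * (n + 1) * besselCoeff ν (n + 1) := by
  have hG := gamma_shift_pos hν (n + 1)
  have e : (n : ℝ) + (ν + 1) + 1 = (n + 1 : ℕ) + ν + 1 := by push_cast; ring
  unfold besselCoeff
  rw [e, Nat.factorial_succ]
  push_cast at hG ⊢
  field_simp
  ring

theorem hasSum_diniCoeff (hν : -1 < ν) (x : ℝ) :
    HasSum (fun n : ℕ => diniCoeff ν n * x ^ n)
      ((∑' n : ℕ, besselCoeff ν n * x ^ n) -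
        x / 2 * ∑' n : ℕ, besselCoeff (ν + 1) n * x ^ n) := by
  have h1 := (summable_besselCoeff hν x).hasSum
  have h2 := ((summable_besselCoeff (ν := ν + 1) (by linarith) x).hasSum).mul_left (x / 2)
  have h3 : HasSum (fun n : ℕ => -2 * n * besselCoeff ν n * x ^ n)
      (x / 2 * ∑' n : ℕ, besselCoeff (ν + 1) n * x ^ n) := by
    rw [← hasSum_nat_add_iff' 1]
    convert! h2 using 1
    · funext n
      rw [besselCoeff_add_one hν]
      push_cast
      ring
    · simp
  convert! h1.sub h3 using 2 with n
  unfold diniCoeff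
  ring

theorem hasFPowerSeriesOnBall_diniEntire (hν : -1 < ν) :
    HasFPowerSeriesOnBall (diniEntire ν)
      (FormalMultilinearSeries.ofScalars ℝ (diniCoeff ν)) 0 ⊤ where
  r_le := by
    refine (FormalMultilinearSeries.radius_eq_top_of_summable_norm _ fun r => ?_).ge
    have := (hasSum_diniCoeff hν r).summable.norm
    simpa [FormalMultilinearSeries.ofScalars_norm] using this
  r_pos := by simp
  hasSum := fun {y} _ => by
    have := (hasSum_diniCoeff hν y).summable.hasSum
    simpa [FormalMultilinearSeries.ofScalars_apply_eq, diniEntire, mul_comm] using this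

theorem analyticAt_diniEntire (hν : -1 < ν) (x : ℝ) : AnalyticAt ℝ (diniEntire ν) x :=
  (hasFPowerSeriesOnBall_diniEntire hν).analyticAt_of_mem (by simp)

theorem diniEntire_zero_pos (hν : -1 < ν) : 0 < diniEntire ν 0 := by
  rw [diniEntire, tsum_eq_single 0 fun n hn => by simp [hn]]
  simpa [diniCoeff] using besselCoeff_zero_pos hν

theorem besselJ_sqrt (ν : ℝ) {x : ℝ} (hx : 0 < x) :
    besselJ ν (√x) = √x ^ ν / 2 ^ ν * ∑' n : ℕ, besselCoeff ν n * x ^ n := by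
  rw [besselJ, ← tsum_mul_left]
  refine tsum_congr fun n => ?_
  have hs : 0 < √x := Real.sqrt_pos.2 hx
  have e (y : ℝ) (hy : 0 < y) : y ^ (2 * (n : ℝ) + ν) = (y ^ 2) ^ n * y ^ ν := by
    rw [Real.rpow_add hy, ← pow_mul, ← Real.rpow_natCast y (2 * n)]
    push_cast
    rfl
  rw [e _ hs, e 2 two_pos, Real.sq_sqrt hx.le, besselCoeff]
  norm_num
  simp only [div_eq_mul_inv, mul_inv]
  ring

theorem dini_sqrt (hν : -1 < ν) {x : ℝ} (hx : 0 < x) :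
    dini ν (√x) = x ^ (ν / 2) / 2 ^ ν * diniEntire ν x := by
  have hs : 0 < √x := Real.sqrt_pos.2 hx
  have e : √x ^ ν = x ^ (ν / 2) := by
    rw [Real.sqrt_eq_rpow, ← Real.rpow_mul hx.le]
    ring_nf
  rw [dini, besselJ_sqrt ν hx, besselJ_sqrt (ν + 1) hx, diniEntire, (hasSum_diniCoeff hν x).tsum_eq,
    Real.rpow_add hs, Real.rpow_add two_pos, Real.rpow_one, Real.rpow_one, ← e]
  linear_combination (-(√x ^ ν / 2 ^ ν) / 2 * ∑' n : ℕ, besselCoeff (ν + 1) n * x ^ n) *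
    Real.mul_self_sqrt hx.le

end Analytic

/-- The formal Taylor series at `0`. -/
noncomputable def taylorSeries (f : ℝ → ℝ) : PowerSeries ℝ :=
  PowerSeries.mk fun n => iteratedDeriv n f 0 / n.factorial

theorem taylorSeries_mul {f g : ℝ → ℝ} (hf : AnalyticAt ℝ f 0) (hg : AnalyticAt ℝ g 0) :
    taylorSeries (f * g) = taylorSeries f * taylorSeries g := by
  ext n
  rw [PowerSeries.coeff_mul, Finset.Nat.sum_antidiagonal_eq_sum_range_succ_mk]
  simp only [taylorSeries, PowerSeries.coeff_mk]
  rw [iteratedDeriv_mul hf.contDiffAt hg.contDiffAt, Finset.sum_div]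
  refine Finset.sum_congr rfl fun i hi => ?_
  rw [Nat.cast_choose ℝ (Nat.lt_succ_iff.1 (Finset.mem_range.1 hi))]
  field_simp

theorem taylorSeries_congr {f g : ℝ → ℝ} (h : f =ᶠ[nhds 0] g) :
    taylorSeries f = taylorSeries g := by
  ext n
  simp only [taylorSeries, PowerSeries.coeff_mk, h.iteratedDeriv_eq n]

theorem taylorSeries_diniEntire {ν : ℝ} (hν : -1 < ν) :
    taylorSeries (diniEntire ν) = diniSeries ν := by
  ext n
  have h := (hasFPowerSeriesOnBall_diniEntire hν).factorial_smul 1 n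
  rw [FormalMultilinearSeries.ofScalars_apply_eq, iteratedFDeriv_apply_eq_iteratedDeriv_mul_prod]
    at h
  simp only [taylorSeries, diniSeries, PowerSeries.coeff_mk]
  simp at h
  rw [← h]
  field_simp

open PowerSeries in
theorem derivative_taylorSeries_exp (A c : ℝ) :
    d⁄dX ℝ (taylorSeries fun s => A * Real.exp (c * s)) =
      C c * taylorSeries fun s => A * Real.exp (c * s) := by
  have h (n : ℕ) : iteratedDeriv n (fun s => A * Real.exp (c * s)) 0 = A * c ^ n := by
    rw [iteratedDeriv_const_mul_field, iteratedDeriv_exp_const_mul]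
    simp
  ext n
  simp only [coeff_derivative, coeff_C_mul, taylorSeries, coeff_mk, h, Nat.factorial_succ, pow_succ]
  push_cast
  field_simp

theorem HasFPowerSeriesOnBall.exists_iteratedDeriv {f : ℝ → ℝ}
    {p : FormalMultilinearSeries ℝ ℝ ℝ} {x : ℝ} {r : ENNReal}
    (h : HasFPowerSeriesOnBall f p x r) (m : ℕ) :
    ∃ q : FormalMultilinearSeries ℝ ℝ ℝ, HasFPowerSeriesOnBall (iteratedDeriv m f) q x r := by
  induction m with
  | zero => exact ⟨p, by simpa using h⟩
  | succ m ih =>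
    obtain ⟨q, hq⟩ := ih
    have := (ContinuousLinearMap.apply ℝ ℝ (1 : ℝ) :
      (ℝ →L[ℝ] ℝ) →L[ℝ] ℝ).comp_hasFPowerSeriesOnBall
      hq.fderiv
    refine ⟨_, this.congr fun y _ => ?_⟩
    simp [iteratedDeriv_succ]

theorem iteratedDeriv_iteratedDeriv (f : ℝ → ℝ) (m n : ℕ) :
    iteratedDeriv n (iteratedDeriv m f) = iteratedDeriv (n + m) f := by
  simp only [iteratedDeriv_eq_iterate, Function.iterate_add_apply]

/-- If all derivatives of an analytic function are nonnegative at a point, then they are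
nonnegative on a right neighbourhood of it. -/
theorem AnalyticAt.eventually_iteratedDeriv_nonneg {f : ℝ → ℝ} {x : ℝ} (hf : AnalyticAt ℝ f x)
    (h : ∀ m, 0 ≤ iteratedDeriv m f x) :
    ∀ᶠ y in nhdsWithin x (Ioi x), ∀ m, 0 ≤ iteratedDeriv m f y := by
  obtain ⟨p, r, hp⟩ := hf
  filter_upwards [self_mem_nhdsWithin, nhdsWithin_le_nhds (Metric.eball_mem_nhds x hp.r_pos)]
    with y hxy hy m
  obtain ⟨q, hq⟩ := hp.exists_iteratedDeriv m
  have hs := hq.hasSum_iteratedFDeriv (y := y - x) (by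
    simpa [edist_eq_enorm_sub] using hy)
  rw [add_sub_cancel] at hs
  refine hs.nonneg fun n => ?_
  rw [iteratedFDeriv_apply_eq_iteratedDeriv_mul_prod, iteratedDeriv_iteratedDeriv]
  have : 0 ≤ y - x := sub_nonneg.2 (le_of_lt hxy)
  have := h (n + m)
  simp only [smul_eq_mul, Finset.prod_const]
  positivity

/-- An analytic function on `[0, b)` with nonnegative Taylor coefficients at `0` is absolutely
monotonic. -/
theorem AnalyticOnNhd.iteratedDeriv_nonneg {f : ℝ → ℝ} {b : ℝ}
    (hf : AnalyticOnNhd ℝ f (Ico 0 b)) (h0 : ∀ m, 0 ≤ iteratedDeriv m f 0) (m : ℕ) {x : ℝ}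
    (hx : x ∈ Ico 0 b) : 0 ≤ iteratedDeriv m f x := by
  have hsub : Icc 0 x ⊆ Ico 0 b := Icc_subset_Ico_right hx.2
  suffices Icc 0 x ⊆ {y | ∀ m, 0 ≤ iteratedDeriv m f y} from
    this (right_mem_Icc.2 hx.1) m
  refine IsClosed.Icc_subset_of_forall_mem_nhdsWithin ?_ h0 fun y hy =>
    (hf y (hsub (Ico_subset_Icc_self hy.2))).eventually_iteratedDeriv_nonneg hy.1
  have e : {y | ∀ m, 0 ≤ iteratedDeriv m f y} ∩ Icc 0 x =
      ⋂ m, Icc 0 x ∩ iteratedDeriv m f ⁻¹' Ici 0 := by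
    ext y
    simp only [mem_inter_iff, mem_ofPred_eq, mem_iInter, mem_preimage, mem_Ici]
    exact ⟨fun h m => ⟨h.2, h.1 m⟩, fun h => ⟨fun m => (h m).2, (h 0).1⟩⟩
  rw [e]
  refine isClosed_iInter fun m => ContinuousOn.preimage_isClosed_of_isClosed ?_ isClosed_Icc
    isClosed_Ici
  rw [iteratedDeriv_eq_iterate]
  exact ((hf.mono hsub).iterated_deriv m).continuousOn

/-- Absolute monotonicity passes from an analytic function to any function agreeing with it on
the open interval, whatever its nonnegative value at `0`: a derivative within `[0, b)` at `0` is
either the default value `0` or the derivative of a monotone function. -/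
theorem iteratedDerivWithin_nonneg_of_eqOn {f k : ℝ → ℝ} {b : ℝ}
    (hk : AnalyticOnNhd ℝ k (Ico 0 b)) (hk0 : ∀ m, 0 ≤ iteratedDeriv m k 0)
    (hfk : EqOn f k (Ioo 0 b)) (hf0 : 0 ≤ f 0) (m : ℕ) {x : ℝ} (hx : x ∈ Ico 0 b) :
    0 ≤ iteratedDerivWithin m f (Ico 0 b) x := by
  have heq (m : ℕ) : EqOn (iteratedDerivWithin m f (Ico 0 b)) (iteratedDeriv m k) (Ioo 0 b) := by
    intro y hy
    have hs : Ico 0 b =ᶠ[nhds y] univ :=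
      eventuallyEq_univ.2 (mem_of_superset (Ioo_mem_nhds hy.1 hy.2) Ioo_subset_Ico_self)
    rw [iteratedDerivWithin_eq_iteratedFDerivWithin, iteratedFDerivWithin_congr_set hs,
      ← iteratedDerivWithin_eq_iteratedFDerivWithin, iteratedDerivWithin_univ]
    exact (hfk.eventuallyEq_of_mem (Ioo_mem_nhds hy.1 hy.2)).iteratedDeriv_eq m
  rcases hx.1.eq_or_lt with rfl | hx0
  · cases m with
    | zero => simpa using hf0
    | succ m =>
      rw [iteratedDerivWithin_succ]
      by_cases hd : DifferentiableWithinAt ℝ (iteratedDerivWithin m f (Ico 0 b)) (Ico 0 b) 0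
      swap
      · rw [derivWithin_zero_of_not_differentiableWithinAt hd]
      have hev {y : ℝ} (hy : y ∈ Ioo 0 b) :
          iteratedDerivWithin m f (Ico 0 b) =ᶠ[nhds y] iteratedDeriv m k :=
        (heq m).eventuallyEq_of_mem (Ioo_mem_nhds hy.1 hy.2)
      have hda {y : ℝ} (hy : y ∈ Ioo 0 b) :
          DifferentiableAt ℝ (iteratedDerivWithin m f (Ico 0 b)) y := by
        refine DifferentiableAt.congr_of_eventuallyEq ?_ (hev hy)
        rw [iteratedDeriv_eq_iterate]
        exact (hk.iterated_deriv m y (Ioo_subset_Ico_self hy)).differentiableAt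
      refine MonotoneOn.derivWithin_nonneg (monotoneOn_of_deriv_nonneg (convex_Ico 0 b) ?_ ?_ ?_)
      · intro y hy
        rcases hy.1.eq_or_lt with rfl | hy0
        · exact hd.continuousWithinAt
        · exact (hda ⟨hy0, hy.2⟩).continuousAt.continuousWithinAt
      · rw [interior_Ico]
        exact fun y hy => (hda hy).differentiableWithinAt
      · rw [interior_Ico]
        intro y hy
        rw [(hev hy).deriv_eq, ← iteratedDeriv_succ]
        exact hk.iteratedDeriv_nonneg hk0 _ (Ioo_subset_Ico_self hy)
  · rw [heq m ⟨hx0, hx.2⟩]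
    exact hk.iteratedDeriv_nonneg hk0 m hx

theorem besselJ_zero_nonneg {ν : ℝ} (hν : -1 < ν) : 0 ≤ besselJ ν 0 := by
  refine tsum_nonneg fun n => ?_
  have hG := gamma_shift_pos hν n
  cases n with
  | zero => positivity
  | succ n =>
    rw [Real.zero_rpow]
    · simp
    · push_cast
      have : (0 : ℝ) ≤ n := n.cast_nonneg
      linarith

/-- Let `μ ≥ ν > -1` and let `a1 = α_{ν,1}` be the first positive zero of
the Dini function `d_ν`.  Then the function
`g_{μ,ν}(x) = x^{(ν-μ)/2} e^{(3x/4)(1/(μ+1) - 1/(ν+1))} d_μ(√x) / d_ν(√x)`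
is absolutely monotonic on `[0, a1²)`: all of its derivatives (within `[0, a1²)`) are
nonnegative there. -/
theorem absolutely_monotonic_g (μ ν : ℝ) (hν : -1 < ν) (hμν : ν ≤ μ)
    (a1 : ℝ) (ha1pos : 0 < a1) (ha1zero : dini ν a1 = 0)
    (ha1min : ∀ y : ℝ, 0 < y → dini ν y = 0 → a1 ≤ y) :
    ∀ m : ℕ, ∀ x ∈ Set.Ico (0 : ℝ) (a1 ^ 2),
      0 ≤ iteratedDerivWithin m
        (fun s : ℝ => s ^ ((ν - μ) / 2) *
          Real.exp (3 * s / 4 * (1 / (μ + 1) - 1 / (ν + 1))) *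
          dini μ (Real.sqrt s) / dini ν (Real.sqrt s))
        (Set.Ico (0 : ℝ) (a1 ^ 2)) x := by
  intro m x hx
  have hμ : -1 < μ := hν.trans_le hμν
  set c := 3 / 4 * (1 / (μ + 1) - 1 / (ν + 1)) with hc
  set A : ℝ := 2 ^ ν / 2 ^ μ with hA
  have hApos : 0 < A := by positivity
  have hne : ∀ s ∈ Ico 0 (a1 ^ 2), diniEntire ν s ≠ 0 := by
    intro s hs h
    rcases hs.1.eq_or_lt with rfl | h0
    · exact (diniEntire_zero_pos hν).ne' h
    · have h1 := ha1min (√s) (Real.sqrt_pos.2 h0) (by rw [dini_sqrt hν h0, h, mul_zero])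
      exact absurd hs.2 (not_lt.2 ((Real.le_sqrt' ha1pos).1 h1))
  have h0mem : (0 : ℝ) ∈ Ico 0 (a1 ^ 2) := ⟨le_rfl, by positivity⟩
  have hexp (s : ℝ) : AnalyticAt ℝ (fun s => A * Real.exp (c * s)) s := by fun_prop
  let k : ℝ → ℝ := fun s => A * Real.exp (c * s) * diniEntire μ s / diniEntire ν s
  have hk : AnalyticOnNhd ℝ k (Ico 0 (a1 ^ 2)) := fun s hs =>
    ((hexp s).mul (analyticAt_diniEntire hμ s)).div (analyticAt_diniEntire hν s) (hne s hs)
  have hmul : taylorSeries k * diniSeries ν =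
      taylorSeries (fun s => A * Real.exp (c * s)) * diniSeries μ := by
    rw [← taylorSeries_diniEntire hν, ← taylorSeries_diniEntire hμ,
      ← taylorSeries_mul (hk 0 h0mem) (analyticAt_diniEntire hν 0),
      ← taylorSeries_mul (hexp 0) (analyticAt_diniEntire hμ 0)]
    refine taylorSeries_congr ?_
    filter_upwards [(analyticAt_diniEntire hν 0).continuousAt.eventually_ne (hne 0 h0mem)]
      with s hs
    exact div_mul_cancel₀ _ hs
  have hk0 (n : ℕ) : 0 ≤ iteratedDeriv n k 0 := by
    have h := coeff_nonneg_of_mul_diniSeries hν hμν (derivative_taylorSeries_exp A c) ?_ hmul n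
    · rw [taylorSeries, PowerSeries.coeff_mk, div_eq_mul_inv] at h
      exact nonneg_of_mul_nonneg_left h (by positivity)
    · have h1 := diniEntire_zero_pos hμ
      have h2 := diniEntire_zero_pos hν
      rw [taylorSeries, PowerSeries.coeff_mk, iteratedDeriv_zero]
      positivity
  refine iteratedDerivWithin_nonneg_of_eqOn hk hk0 ?_ ?_ m hx
  · intro s hs
    have hs0 : 0 < s := hs.1
    have e : 3 * s / 4 * (1 / (μ + 1) - 1 / (ν + 1)) = c * s := by rw [hc]; ring
    have h1 := hne s (Ioo_subset_Ico_self hs)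
    simp only [k]
    rw [e, dini_sqrt hμ hs0, dini_sqrt hν hs0, sub_div, Real.rpow_sub hs0, hA]
    field_simp
  · have h1 := besselJ_zero_nonneg hμ
    have h2 := besselJ_zero_nonneg hν
    simp only [Real.sqrt_zero, dini, zero_mul, sub_zero]
    positivity
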